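/- For every integer k ≥ 1 there exists an integer K = K(k) such that for every k-tangle τ in a graph G there exists a weight function w : V(G) → ℕ which induces τ and whose total weight w(V(G)) = Σ_{v ∈ V(G)} w(v) is at most K. In particular, the support of w has size at most K. -/

import Mathlib

open Finset

variable {V : Type} [Fintype V] [DecidableEq V]

/-- `{A, B}` is a separation of the graph `G`: the two sides together cover the vertex set and
no edge of `G` joins `A \ B` to `B \ A`. -/
def IsSep (G : SimpleGraph V) (A B : Finset V) : Prop :=
  A ∪ B = Finset.univ ∧ ∀ a ∈ A \ B, ∀ b ∈ B \ A, ¬ G.Adj a b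

/-- `G[A₁] ∪ G[A₂] ∪ G[A₃] = G` for the induced subgraphs on `A₁`, `A₂`, `A₃`. -/
def CoversG (G : SimpleGraph V) (A₁ A₂ A₃ : Finset V) : Prop :=
  (∀ v : V, v ∈ A₁ ∨ v ∈ A₂ ∨ v ∈ A₃) ∧
    ∀ u v : V, G.Adj u v →
      (u ∈ A₁ ∧ v ∈ A₁) ∨ (u ∈ A₂ ∧ v ∈ A₂) ∨ (u ∈ A₃ ∧ v ∈ A₃)

/-- `τ` is a `k`-tangle in `G`: a set of oriented separations of order `< k` containing exactly
one orientation of every separation of order `< k`, and no three of its elements have small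
sides whose induced subgraphs together cover `G`. -/
def IsTangle (G : SimpleGraph V) (k : ℕ) (τ : Set (Finset V × Finset V)) : Prop :=
  (∀ p ∈ τ, IsSep G p.1 p.2 ∧ (p.1 ∩ p.2).card < k) ∧
    (∀ A B : Finset V, IsSep G A B → (A ∩ B).card < k → ((A, B) ∈ τ ↔ (B, A) ∉ τ)) ∧
    ∀ p₁ ∈ τ, ∀ p₂ ∈ τ, ∀ p₃ ∈ τ, ¬ CoversG G p₁.1 p₂.1 p₃.1

/-- The weight function `w` induces the tangle `τ`. -/
def InducesW (τ : Set (Finset V × Finset V)) (w : V → ℕ) : Prop :=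
  ∀ p ∈ τ, ∑ x ∈ p.1, w x < ∑ x ∈ p.2, w x

theorem card_le_card_of_pairwiseDisjoint_of_meets {ι α : Type*} (I : Finset ι)
    (R : ι → Finset α) (T : Finset α) (hR : (I : Set ι).PairwiseDisjoint R)
    (hT : ∀ i ∈ I, ∃ a ∈ R i, a ∈ T) : #I ≤ #T := by
  rcases isEmpty_or_nonempty α with hα | hα
  · have : I = ∅ := eq_empty_of_forall_notMem fun i hi => hα.false (hT i hi).choose
    simp [this]
  choose! f hf hfT using hT
  refine card_le_card_of_injOn f hfT fun i hi j hj hij => ?_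
  by_contra hne
  exact disjoint_left.1 (hR hi hj hne) (hf i hi) (hij ▸ hf j hj)

variable {α : Type*} [DecidableEq α]

/-- `W` is connected in `G`, phrased through cuts: every vertex set that splits `W` is crossed
by an edge of `G` inside `W`. -/
def CutConnected (G : SimpleGraph α) (W : Finset α) : Prop :=
  ∀ T : Finset α, (W ∩ T).Nonempty → (W \ T).Nonempty → ∃ a ∈ W ∩ T, ∃ b ∈ W \ T, G.Adj a b

theorem CutConnected.singleton (G : SimpleGraph α) (x : α) : CutConnected G {x} := by
  rintro T ⟨a, ha⟩ ⟨b, hb⟩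
  simp only [mem_inter, mem_sdiff, mem_singleton] at ha hb
  grind

theorem CutConnected.union {G : SimpleGraph α} {P Q : Finset α} (hP : CutConnected G P)
    (hQ : CutConnected G Q) (h : (∃ a ∈ P, a ∈ Q) ∨ ∃ a ∈ P, ∃ b ∈ Q, G.Adj a b) :
    CutConnected G (P ∪ Q) := by
  rintro T ⟨a, ha⟩ ⟨b, hb⟩
  by_cases hP' : (P ∩ T).Nonempty ∧ (P \ T).Nonempty
  · obtain ⟨a, ha, b, hb, hab⟩ := hP T hP'.1 hP'.2
    exact ⟨a, by grind, b, by grind, hab⟩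
  by_cases hQ' : (Q ∩ T).Nonempty ∧ (Q \ T).Nonempty
  · obtain ⟨a, ha, b, hb, hab⟩ := hQ T hQ'.1 hQ'.2
    exact ⟨a, by grind, b, by grind, hab⟩
  have hP1 : ∀ u ∈ P, ∀ v ∈ P, u ∈ T → v ∈ T := fun u hu v hv huT => by
    by_contra hvT
    exact hP' ⟨⟨u, by grind⟩, ⟨v, by grind⟩⟩
  have hQ1 : ∀ u ∈ Q, ∀ v ∈ Q, u ∈ T → v ∈ T := fun u hu v hv huT => by
    by_contra hvT
    exact hQ' ⟨⟨u, by grind⟩, ⟨v, by grind⟩⟩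
  rcases h with ⟨c, hc1, hc2⟩ | ⟨c, hc, d, hd, hcd⟩
  · grind
  · by_cases hcT : c ∈ T
    · exact ⟨c, by grind, d, by grind, hcd⟩
    · exact ⟨d, by grind, c, by grind, hcd.symm⟩

/-- The component of `x` in the subgraph induced on `R`. -/
noncomputable def componentIn (G : SimpleGraph α) (R : Finset α) (x : α) : Finset α :=
  open Classical in {y ∈ R | ∃ Q ⊆ R, CutConnected G Q ∧ x ∈ Q ∧ y ∈ Q}

theorem mem_componentIn {G : SimpleGraph α} {R : Finset α} {x y : α} :
    y ∈ componentIn G R x ↔ ∃ Q ⊆ R, CutConnected G Q ∧ x ∈ Q ∧ y ∈ Q := by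
  simp only [componentIn, mem_filter]
  exact ⟨fun h => h.2, fun ⟨Q, hQ, h⟩ => ⟨hQ h.2.2, Q, hQ, h⟩⟩

theorem componentIn_subset {G : SimpleGraph α} {R : Finset α} {x : α} :
    componentIn G R x ⊆ R := by
  intro y hy
  obtain ⟨Q, hQ, -, -, hy⟩ := mem_componentIn.1 hy
  exact hQ hy

theorem self_mem_componentIn {G : SimpleGraph α} {R : Finset α} {x : α} (hx : x ∈ R) :
    x ∈ componentIn G R x :=
  mem_componentIn.2 ⟨{x}, by simpa using hx, .singleton G x, by simp, by simp⟩

theorem cutConnected_componentIn (G : SimpleGraph α) (R : Finset α) (x : α) :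
    CutConnected G (componentIn G R x) := by
  rintro T ⟨a, ha⟩ ⟨b, hb⟩
  rw [mem_inter] at ha
  rw [mem_sdiff] at hb
  obtain ⟨P, hPR, hP, hxP, haP⟩ := mem_componentIn.1 ha.1
  obtain ⟨Q, hQR, hQ, hxQ, hbQ⟩ := mem_componentIn.1 hb.1
  have hsub : P ∪ Q ⊆ componentIn G R x := fun y hy =>
    mem_componentIn.2 ⟨P ∪ Q, union_subset hPR hQR, hP.union hQ (.inl ⟨x, hxP, hxQ⟩),
      by grind, hy⟩
  obtain ⟨c, hc, d, hd, hcd⟩ := hP.union hQ (.inl ⟨x, hxP, hxQ⟩) T ⟨a, by grind⟩ ⟨b, by grind⟩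
  exact ⟨c, by grind, d, by grind, hcd⟩

theorem mem_componentIn_of_adj {G : SimpleGraph α} {R : Finset α} {x a b : α}
    (ha : a ∈ componentIn G R x) (hb : b ∈ R) (hab : G.Adj a b) : b ∈ componentIn G R x := by
  obtain ⟨P, hPR, hP, hxP, haP⟩ := mem_componentIn.1 ha
  exact mem_componentIn.2 ⟨P ∪ {b}, union_subset hPR (by simpa using hb),
    hP.union (.singleton G b) (.inr ⟨a, haP, b, by simp, hab⟩), by grind, by grind⟩

theorem mem_componentIn_trans {G : SimpleGraph α} {R : Finset α} {x y c : α}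
    (hx : c ∈ componentIn G R x) (hy : c ∈ componentIn G R y) : y ∈ componentIn G R x := by
  obtain ⟨P, hPR, hP, hxP, hcP⟩ := mem_componentIn.1 hx
  obtain ⟨Q, hQR, hQ, hyQ, hcQ⟩ := mem_componentIn.1 hy
  exact mem_componentIn.2 ⟨P ∪ Q, union_subset hPR hQR, hP.union hQ (.inl ⟨c, hcP, hcQ⟩),
    by grind, by grind⟩

/-- A piece split off a connected set: `P` contains at least two vertices of `X`, its complement
in `W` is still connected, and either `P` contains few vertices of `X` or there is a large star
of disjoint connected sets leading to vertices of `X`. -/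
theorem CutConnected.exists_piece_or_star {G : SimpleGraph α} {W X : Finset α}
    (hW : CutConnected G W) (hX : 2 ≤ #(W ∩ X)) (m : ℕ) :
    (∃ P ⊆ W, CutConnected G P ∧ CutConnected G (W \ P) ∧ 2 ≤ #(P ∩ X) ∧ #(P ∩ X) ≤ m) ∨
    ∃ z ∈ W, ∃ X' ⊆ X, #X' = m ∧ ∃ R : α → Finset α, (X' : Set α).PairwiseDisjoint R ∧
      ∀ x ∈ X', x ∈ R x ∧ R x ⊆ W ∧ CutConnected G (insert z (R x)) := by
  classical
  let good : Finset (Finset α) :=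
    {P ∈ W.powerset | CutConnected G P ∧ CutConnected G (W \ P) ∧ 2 ≤ #(P ∩ X)}
  have hne : good.Nonempty := by
    refine ⟨W, ?_⟩
    simp only [good, mem_filter, mem_powerset, Subset.refl, true_and]
    refine ⟨hW, ?_, hX⟩
    rintro T ⟨a, ha⟩ -
    simp at ha
  obtain ⟨P, hPgood, hPmin⟩ := exists_min_image good card hne
  simp only [good, mem_filter, mem_powerset] at hPgood
  obtain ⟨hPW, hP, hPc, hP2⟩ := hPgood
  have hPne : P.Nonempty := by
    rw [nonempty_iff_ne_empty]; rintro rfl; simp at hP2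
  obtain ⟨z, hzP, hz⟩ : ∃ z ∈ P, (W \ P).Nonempty → ∃ q ∈ W \ P, G.Adj z q := by
    by_cases h : (W \ P).Nonempty
    · obtain ⟨a, ha, b, hb, hab⟩ := hW P (by rwa [inter_eq_right.2 hPW]) h
      exact ⟨a, (mem_inter.1 ha).2, fun _ => ⟨b, hb, hab⟩⟩
    · obtain ⟨z, hz⟩ := hPne
      exact ⟨z, hz, fun h' => absurd h' h⟩
  let R : α → Finset α := componentIn G (P.erase z)
  have hRP : ∀ x, R x ⊆ P.erase z := fun x => componentIn_subset
  have hadj : ∀ x ∈ P.erase z, ∃ a ∈ R x, G.Adj a z := by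
    intro x hx
    obtain ⟨a, ha, b, hb, hab⟩ := hP (R x)
      ⟨x, mem_inter.2 ⟨mem_of_mem_erase hx, self_mem_componentIn hx⟩⟩
      ⟨z, mem_sdiff.2 ⟨hzP, fun h => by simpa using hRP x h⟩⟩
    rw [mem_inter] at ha
    rw [mem_sdiff] at hb
    by_cases hbz : b = z
    · exact ⟨a, ha.2, hbz ▸ hab⟩
    · exact absurd (mem_componentIn_of_adj ha.2 (mem_erase.2 ⟨hbz, hb.1⟩) hab) hb.2
  have hco : ∀ x, CutConnected G (W \ R x) := by
    intro x
    have key : ∀ T : Finset α, z ∈ T → ((W \ R x) \ T).Nonempty →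
        ∃ a ∈ (W \ R x) ∩ T, ∃ b ∈ (W \ R x) \ T, G.Adj a b := by
      rintro T hzT ⟨b, hb⟩
      simp only [mem_sdiff] at hb
      have hzR : z ∉ R x := fun h => by simpa using hRP x h
      by_cases hbP : b ∈ P
      · obtain ⟨c, hc, d, hd, hcd⟩ := hP ((P \ R x) \ T) ⟨b, by grind⟩ ⟨z, by grind⟩
        have hdR : d ∉ R x := fun h => by
          have := mem_componentIn_of_adj (b := c) h (by grind) hcd.symm
          grind
        exact ⟨d, by grind, c, by grind, hcd.symm⟩
      · by_cases h : ((W \ P) ∩ T).Nonempty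
        · obtain ⟨c, hc, d, hd, hcd⟩ := hPc T h ⟨b, by grind⟩
          have := hRP x
          exact ⟨c, by grind, d, by grind, hcd⟩
        · obtain ⟨q, hq, hzq⟩ := hz ⟨b, by grind⟩
          have hqT : q ∉ T := fun h' => h ⟨q, by grind⟩
          have := hRP x
          exact ⟨z, by grind, q, by grind, hzq⟩
    rintro T ⟨a, ha⟩ hb
    by_cases hzT : z ∈ T
    · exact key T hzT hb
    · simp only [mem_inter, mem_sdiff] at ha
      obtain ⟨c, hc, d, hd, hcd⟩ := key (W \ T) (mem_sdiff.2 ⟨hPW hzP, hzT⟩) ⟨a, by simp [ha]⟩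
      simp only [mem_inter, mem_sdiff, not_and, not_not] at hc hd
      exact ⟨d, by simp [hd], c, by simp [hc], hcd.symm⟩
  have hRX : ∀ x ∈ P.erase z, #(R x ∩ X) ≤ 1 := by
    intro x hx
    by_contra! h
    have h1 := hPmin (R x) (by
      simp only [good, mem_filter, mem_powerset]
      exact ⟨((hRP x).trans (erase_subset _ _)).trans hPW, cutConnected_componentIn _ _ _,
        hco x, h⟩)
    have h2 := card_le_card (hRP x)
    have h3 := card_erase_lt_of_mem hzP
    omega
  by_cases hm : m ≤ #((P ∩ X).erase z)
  · right
    obtain ⟨X', hX', hcard⟩ := exists_subset_card_eq hm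
    have hX'P : ∀ x ∈ X', x ∈ P.erase z ∧ x ∈ X := fun x hx => by
      have := hX' hx
      grind
    refine ⟨z, hPW hzP, X', fun x hx => (hX'P x hx).2, hcard, R, ?_, ?_⟩
    · intro x hx y hy hxy
      refine disjoint_left.2 fun c hcx hcy => hxy ?_
      have h1 := mem_componentIn_trans hcx hcy
      have h2 := self_mem_componentIn (G := G) (hX'P x hx).1
      exact card_le_one.1 (hRX x (hX'P x hx).1) x (mem_inter.2 ⟨h2, (hX'P x hx).2⟩) y
        (mem_inter.2 ⟨h1, (hX'P y hy).2⟩)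
    · intro x hx
      have hxP := (hX'P x hx).1
      obtain ⟨a, ha, haz⟩ := hadj x hxP
      refine ⟨self_mem_componentIn hxP, ((hRP x).trans (erase_subset _ _)).trans hPW, ?_⟩
      rw [insert_eq]
      exact (CutConnected.singleton G z).union (cutConnected_componentIn _ _ _)
        (.inr ⟨z, by simp, a, ha, haz.symm⟩)
  · left
    refine ⟨P, hPW, hP, hPc, hP2, ?_⟩
    have := pred_card_le_card_erase (s := P ∩ X) (a := z)
    omega

/-- A connected set containing many vertices of `X` contains many disjoint connected sets with two
vertices of `X` each, or a large star of disjoint connected sets leading to vertices of `X`. -/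
theorem CutConnected.exists_packing_or_star {G : SimpleGraph α} {X : Finset α} (m n : ℕ)
    {W : Finset α} (hW : CutConnected G W) (hX : n * (m + 2) ≤ #(W ∩ X)) :
    (∃ Ps : Finset (Finset α), #Ps = n ∧ (Ps : Set (Finset α)).PairwiseDisjoint id ∧
      ∀ P ∈ Ps, P ⊆ W ∧ CutConnected G P ∧ 2 ≤ #(P ∩ X)) ∨
    ∃ z ∈ W, ∃ X' ⊆ X, #X' = m ∧ ∃ R : α → Finset α, (X' : Set α).PairwiseDisjoint R ∧
      ∀ x ∈ X', x ∈ R x ∧ R x ⊆ W ∧ CutConnected G (insert z (R x)) := by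
  induction n generalizing W with
  | zero => exact .inl ⟨∅, by simp⟩
  | succ n ih =>
    have h2 : n * (m + 2) + m + 2 ≤ #(W ∩ X) := by linarith
    rcases hW.exists_piece_or_star (X := X) (by omega) m with
      ⟨P, hPW, hP, hPc, hP2, hPm⟩ | h
    · have hsplit : #(W ∩ X) ≤ #(P ∩ X) + #((W \ P) ∩ X) := by
        refine (card_le_card ?_).trans (card_union_le _ _)
        grind
      rcases ih hPc (by omega) with ⟨Ps, hcard, hdis, hPs⟩ | ⟨z, hz, X', hX', hm, R, hR, h⟩
      · left
        have hPd : ∀ Q ∈ Ps, Disjoint P Q := fun Q hQ =>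
          disjoint_left.2 fun a haP haQ => (mem_sdiff.1 ((hPs Q hQ).1 haQ)).2 haP
        have hPn : P ∉ Ps := fun h => by
          have := hPd P h
          rw [disjoint_self] at this
          simp [this] at hP2
        refine ⟨insert P Ps, by rw [card_insert_of_notMem hPn, hcard], ?_, ?_⟩
        · rw [coe_insert]
          exact hdis.insert fun Q hQ _ => hPd Q hQ
        · intro Q hQ
          rcases mem_insert.1 hQ with rfl | hQ
          · exact ⟨hPW, hP, hP2⟩
          · exact ⟨(hPs Q hQ).1.trans sdiff_subset, (hPs Q hQ).2⟩
      · exact .inr ⟨z, sdiff_subset hz, X', hX', hm, R, hR, fun x hx =>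
          ⟨(h x hx).1, (h x hx).2.1.trans sdiff_subset, (h x hx).2.2⟩⟩
    · exact .inr h

/-- `C` is a connected set disjoint from `S` all of whose outside neighbours lie in `S`. -/
structure IsComponentOff (G : SimpleGraph α) (S C : Finset α) : Prop where
  disjoint : Disjoint C S
  connected : CutConnected G C
  closed : ∀ a ∈ C, ∀ b, G.Adj a b → b ∈ C ∨ b ∈ S

theorem IsComponentOff.mem_of_mem {G : SimpleGraph α} {S C Q : Finset α}
    (h : IsComponentOff G S C) (hQ : CutConnected G Q) (hQS : ∀ a ∈ Q, a ∉ S) {a b : α}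
    (ha : a ∈ Q) (hb : b ∈ Q) (haC : a ∈ C) : b ∈ C := by
  by_contra hbC
  obtain ⟨c, hc, d, hd, hcd⟩ := hQ C ⟨a, by grind⟩ ⟨b, by grind⟩
  have := h.closed c (mem_inter.1 hc).2 d hcd
  grind

/-- A bound on the size of vertex sets shattered by components after deleting fewer than `k`
vertices. -/
def shatterBound : ℕ → ℕ
  | 0 => 0
  | k + 1 => (k + 1) * (2 * (k + 1) + shatterBound k + 2)

theorem card_lt_shatterBound {G : SimpleGraph α} (k : ℕ) (Z : Finset α)
    (F : Set (Finset α × Finset α))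
    (hF : ∀ p ∈ F, IsComponentOff G p.1 p.2 ∧ Z ⊆ p.1 ∧ #(p.1 \ Z) < k) (X : Finset α)
    (hX : ∀ Y ⊆ X, ∃ p ∈ F, X ∩ p.2 = Y) : #X < shatterBound k := by
  induction k generalizing Z F X with
  | zero =>
    obtain ⟨p, hp, -⟩ := hX ∅ (by simp)
    have := (hF p hp).2.2
    omega
  | succ k ih =>
    by_contra! hcard
    obtain ⟨⟨S₀, C₀⟩, hp₀, hXC₀⟩ := hX X Subset.rfl
    obtain ⟨hC₀, hZ₀, -⟩ := hF _ hp₀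
    have hC₀Z : ∀ a ∈ C₀, a ∉ Z := fun a ha haZ =>
      disjoint_left.1 hC₀.disjoint ha (hZ₀ haZ)
    rcases hC₀.connected.exists_packing_or_star (X := X) (2 * (k + 1) + shatterBound k) (k + 1)
      (by rw [inter_comm, hXC₀]; exact hcard) with ⟨Ps, hPscard, hdis, hPs⟩ |
        ⟨z, hz, X', hX', hm, R, hR, h⟩
    · have hex : ∀ P ∈ Ps, ∃ x y, x ∈ P ∧ x ∈ X ∧ y ∈ P ∧ y ∈ X ∧ x ≠ y := by
        intro P hP
        obtain ⟨x, hx, y, hy, hxy⟩ := one_lt_card.1 (hPs P hP).2.2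
        exact ⟨x, y, by grind⟩
      have : Nonempty α := by
        obtain ⟨P, hP⟩ := card_pos.1 (by omega : 0 < #Ps)
        exact ⟨(hex P hP).choose⟩
      choose! f g hf hfX hg hgX hfg using hex
      obtain ⟨⟨S, C⟩, hp, hXC⟩ := hX (Ps.image f) (by
        intro x hx
        obtain ⟨P, hP, rfl⟩ := mem_image.1 hx
        exact hfX P hP)
      obtain ⟨hC, hZ, hlt⟩ := hF _ hp
      refine absurd (card_le_card_of_pairwiseDisjoint_of_meets Ps id (S \ Z) hdis ?_)
        (by simp only at hlt; omega)
      intro P hP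
      by_contra! hcon
      have hPS : ∀ a ∈ P, a ∉ S := fun a ha haS =>
        hcon a ha (mem_sdiff.2 ⟨haS, hC₀Z a ((hPs P hP).1 ha)⟩)
      have hfC : f P ∈ C := by
        have : f P ∈ X ∩ C := by rw [hXC]; exact mem_image_of_mem f hP
        exact (mem_inter.1 this).2
      have hgC := hC.mem_of_mem (hPs P hP).2.1 hPS (hf P hP) (hg P hP) hfC
      have hgim : g P ∈ Ps.image f := by rw [← hXC]; exact mem_inter.2 ⟨hgX P hP, hgC⟩
      obtain ⟨P', hP', hP'eq⟩ := mem_image.1 hgim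
      by_cases hPP : P = P'
      · subst hPP
        exact hfg P hP hP'eq
      · exact disjoint_left.1 (hdis hP hP' hPP) (hg P hP) (hP'eq ▸ hf P' hP')
    · obtain ⟨In, hIn, hIncard⟩ := exists_subset_card_eq (s := X') (n := k + 1) (by omega)
      obtain ⟨Out, hOut, hOutcard⟩ := exists_subset_card_eq (s := X' \ In) (n := k + 1) (by
        rw [card_sdiff_of_subset hIn]; omega)
      have hrest : #((X' \ In) \ Out) = shatterBound k := by
        rw [card_sdiff_of_subset hOut, card_sdiff_of_subset hIn]; omega
      refine absurd (ih (insert z Z) {p ∈ F | z ∈ p.1} ?_ ((X' \ In) \ Out) ?_) (by omega)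
      · rintro ⟨S, C⟩ ⟨hp, hzS⟩
        obtain ⟨hC, hZ, hlt⟩ := hF _ hp
        refine ⟨hC, insert_subset hzS hZ, ?_⟩
        have : S \ insert z Z = (S \ Z).erase z := by grind
        have hz' : z ∈ S \ Z := mem_sdiff.2 ⟨hzS, hC₀Z z hz⟩
        have h3 := card_erase_lt_of_mem hz'
        simp only at hlt ⊢
        rw [this]
        omega
      · intro Y hY
        have hYX : Y ⊆ X' := hY.trans (sdiff_subset.trans sdiff_subset)
        obtain ⟨⟨S, C⟩, hp, hXC⟩ := hX (Y ∪ In) (union_subset (hYX.trans hX') (hIn.trans hX'))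
        obtain ⟨hC, hZ, hlt⟩ := hF _ hp
        simp only at hXC hlt
        have hmem : ∀ x ∈ X, x ∈ C ↔ x ∈ Y ∪ In := fun x hx => by
          rw [← hXC]; simp [hx]
        refine ⟨(S, C), ⟨hp, ?_⟩, ?_⟩
        · by_contra hzS
          simp only at hzS
          have hfree : ∀ I ⊆ X', #I = k + 1 → ∃ x ∈ I, ∀ a ∈ insert z (R x), a ∉ S := by
            intro I hI hIcard
            by_contra! hcon
            refine absurd (card_le_card_of_pairwiseDisjoint_of_meets I R (S \ Z)
              (hR.subset (by exact_mod_cast hI)) ?_) (by omega)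
            intro x hx
            obtain ⟨a, ha, haS⟩ := hcon x hx
            have haR : a ∈ R x := by
              rcases mem_insert.1 ha with rfl | ha
              · exact absurd haS hzS
              · exact ha
            exact ⟨a, haR, mem_sdiff.2 ⟨haS, hC₀Z a ((h x (hI hx)).2.1 haR)⟩⟩
          obtain ⟨x, hx, hxS⟩ := hfree In hIn hIncard
          obtain ⟨y, hy, hyS⟩ := hfree Out (hOut.trans sdiff_subset) hOutcard
          have hyX' : y ∈ X' := (hOut.trans sdiff_subset) hy
          have hzC := hC.mem_of_mem (h x (hIn hx)).2.2 hxS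
            (mem_insert_of_mem (h x (hIn hx)).1) (mem_insert_self _ _)
            ((hmem x (hX' (hIn hx))).2 (mem_union_right _ hx))
          have hyC := hC.mem_of_mem (h y hyX').2.2 hyS (mem_insert_self _ _)
            (mem_insert_of_mem (h y hyX').1) hzC
          have := (hmem y (hX' hyX')).1 hyC
          grind
        · ext x
          simp only [mem_inter, mem_sdiff]
          have := hmem x
          have := @hX' x
          have := @hY x
          grind

/-- `p` is a maximal element of `τ` in the usual order on oriented separations. -/
def IsMaxSep {α : Type*} (τ : Set (Finset α × Finset α)) (p : Finset α × Finset α) : Prop :=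
  p ∈ τ ∧ ∀ q ∈ τ, p.1 ⊆ q.1 → q.2 ⊆ p.2 → q = p

theorem exists_isMaxSep {τ : Set (Finset V × Finset V)} {p : Finset V × Finset V} (hp : p ∈ τ) :
    ∃ q, IsMaxSep τ q ∧ p.1 ⊆ q.1 ∧ q.2 ⊆ p.2 := by
  classical
  obtain ⟨q, hq, hmax⟩ := exists_max_image
    (univ.filter fun q : Finset V × Finset V => q ∈ τ ∧ p.1 ⊆ q.1 ∧ q.2 ⊆ p.2)
    (fun q => #q.1 + #q.2ᶜ) ⟨p, by simp [hp]⟩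
  simp only [mem_filter, mem_univ, true_and] at hq hmax
  refine ⟨q, ⟨hq.1, fun r hr h1 h2 => ?_⟩, hq.2⟩
  have h := hmax r ⟨hr, hq.2.1.trans h1, h2.trans hq.2.2⟩
  have h3 := card_le_card h1
  have h4 := card_le_card (compl_subset_compl.2 h2)
  refine Prod.ext (eq_of_subset_of_card_le h1 (by omega)).symm ?_
  exact compl_injective (eq_of_subset_of_card_le (compl_subset_compl.2 h2) (by omega)).symm

/-- The sign with which a vertex votes for the big side of an oriented separation. -/
def sideSign {α : Type*} [DecidableEq α] (p : Finset α × Finset α) (v : α) : ℝ :=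
  (if v ∈ p.2 then 1 else 0) - (if v ∈ p.1 then 1 else 0)

theorem sum_sideSign {α : Type*} [DecidableEq α] (p : Finset α × Finset α) (S : Finset α) :
    ∑ v ∈ S, sideSign p v = (#(S ∩ p.2) : ℝ) - #(S ∩ p.1) := by
  simp [sideSign, sum_sub_distrib]

theorem IsSep.mem_or_mem {G : SimpleGraph V} {A B : Finset V} (h : IsSep G A B) (v : V) :
    v ∈ A ∨ v ∈ B := by
  rw [← mem_union, h.1]
  exact mem_univ v

theorem IsSep.adj_cases {G : SimpleGraph V} {A B : Finset V} (h : IsSep G A B) {u v : V}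
    (huv : G.Adj u v) : (u ∈ A ∧ v ∈ A) ∨ (u ∈ B ∧ v ∈ B) := by
  have h1 := fun h1 h2 => h.2 u h1 v h2 huv
  have h2 := fun h1 h2 => h.2 v h1 u h2 huv.symm
  have := h.mem_or_mem u
  have := h.mem_or_mem v
  simp only [mem_sdiff] at h1 h2
  tauto

namespace IsTangle

variable {G : SimpleGraph V} {k : ℕ} {τ : Set (Finset V × Finset V)}

theorem sdiff_nonempty (hτ : IsTangle G k τ) {p : Finset V × Finset V} (hp : p ∈ τ) :
    (p.2 \ p.1).Nonempty := by
  by_contra h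
  have hall : ∀ v, v ∈ p.1 := fun v => by
    by_contra hv
    exact h ⟨v, mem_sdiff.2 ⟨((hτ.1 p hp).1.mem_or_mem v).resolve_left hv, hv⟩⟩
  exact hτ.2.2 p hp p hp p hp ⟨fun v => .inl (hall v), fun u v _ => .inl ⟨hall u, hall v⟩⟩

theorem two_le_sum_sideSign (hτ : IsTangle G k τ) {p q : Finset V × Finset V}
    (hp : IsMaxSep τ p) (hq : IsMaxSep τ q) (hpq : p ≠ q) :
    2 ≤ ∑ v ∈ p.1 ∩ p.2, sideSign q v + ∑ v ∈ q.1 ∩ q.2, sideSign p v := by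
  obtain ⟨A, B⟩ := p
  obtain ⟨C, D⟩ := q
  obtain ⟨hAB, hABk⟩ := hτ.1 _ hp.1
  obtain ⟨hCD, hCDk⟩ := hτ.1 _ hq.1
  simp only at hAB hABk hCD hCDk
  have hAB' := hAB.mem_or_mem
  have hCD' := hCD.mem_or_mem
  have hcorner : k ≤ #((A ∪ C) ∩ (B ∩ D)) := by
    by_contra! hlt
    have hsep : IsSep G (A ∪ C) (B ∩ D) := by
      refine ⟨?_, ?_⟩
      · ext v
        have := hAB' v
        have := hCD' v
        simp only [mem_union, mem_inter, mem_univ, iff_true]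
        tauto
      · intro a ha b hb hab
        simp only [mem_union, mem_inter, mem_sdiff] at ha hb
        rcases hAB.adj_cases hab with h1 | h1 <;> rcases hCD.adj_cases hab with h2 | h2 <;> tauto
    by_cases hmem : (A ∪ C, B ∩ D) ∈ τ
    · have e1 := hp.2 _ hmem subset_union_left inter_subset_left
      have e2 := hq.2 _ hmem subset_union_right inter_subset_right
      exact hpq (e1.symm.trans e2)
    · have hsep' : IsSep G (B ∩ D) (A ∪ C) :=
        ⟨by rw [union_comm]; exact hsep.1, fun a ha b hb hab => hsep.2 b hb a ha hab.symm⟩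
      have hmem' : (B ∩ D, A ∪ C) ∈ τ :=
        (hτ.2.1 _ _ hsep' (by rwa [inter_comm])).2 hmem
      refine hτ.2.2 _ hp.1 _ hq.1 _ hmem' ⟨fun v => ?_, fun u v huv => ?_⟩
      · have := hAB' v
        have := hCD' v
        simp only [mem_inter]
        tauto
      · simp only [mem_inter]
        rcases hAB.adj_cases huv with h1 | h1
        · exact .inl h1
        rcases hCD.adj_cases huv with h2 | h2
        · exact .inr (.inl h2)
        · exact .inr (.inr ⟨⟨h1.1, h2.1⟩, h1.2, h2.2⟩)
  have e1 : #((A ∪ C) ∩ (B ∩ D)) + #((A ∩ B) ∩ (C ∩ D)) =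
      #((A ∩ B) ∩ D) + #((C ∩ D) ∩ B) := by
    rw [← card_union_add_card_inter ((A ∩ B) ∩ D)]
    congr 2 <;> ext v <;> simp only [mem_union, mem_inter] <;> tauto
  have e2 : #(A ∩ B) + #((A ∩ B) ∩ (C ∩ D)) = #((A ∩ B) ∩ D) + #((A ∩ B) ∩ C) := by
    rw [← card_union_add_card_inter ((A ∩ B) ∩ D)]
    congr 2 <;> ext v <;> have := hCD' v <;> simp only [mem_union, mem_inter] <;> tauto
  have e3 : #(C ∩ D) + #((A ∩ B) ∩ (C ∩ D)) = #((C ∩ D) ∩ B) + #((C ∩ D) ∩ A) := by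
    rw [← card_union_add_card_inter ((C ∩ D) ∩ B)]
    congr 2 <;> ext v <;> have := hAB' v <;> simp only [mem_union, mem_inter] <;> tauto
  rw [sum_sideSign, sum_sideSign]
  have key : 2 + #((A ∩ B) ∩ C) + #((C ∩ D) ∩ A) ≤ #((A ∩ B) ∩ D) + #((C ∩ D) ∩ B) := by
    omega
  have key' : (2 : ℝ) + #((A ∩ B) ∩ C) + #((C ∩ D) ∩ A) ≤
      #((A ∩ B) ∩ D) + #((C ∩ D) ∩ B) := by
    exact_mod_cast key
  simp only
  linarith

theorem isComponentOff (hτ : IsTangle G k τ) {p : Finset V × Finset V} (hp : IsMaxSep τ p) :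
    IsComponentOff G (p.1 ∩ p.2) (p.2 \ p.1) := by
  obtain ⟨A, B⟩ := p
  obtain ⟨hAB, hABk⟩ := hτ.1 _ hp.1
  simp only at hAB hABk ⊢
  have hAB' := hAB.mem_or_mem
  refine ⟨?_, ?_, ?_⟩
  · rw [disjoint_left]
    intro v
    simp only [mem_inter, mem_sdiff]
    tauto
  · by_contra hcon
    simp only [CutConnected, not_forall, not_exists, not_and] at hcon
    obtain ⟨T, hT1, hT2, hT⟩ := hcon
    have hT' : ∀ a b, G.Adj a b → a ∈ B → a ∉ A → a ∈ T → b ∈ B → b ∉ A → b ∈ T := by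
      intro a b hab h1 h2 h3 h4 h5
      by_contra h6
      exact hT a (by simp [h1, h2, h3]) b (by simp [h4, h5, h6]) hab
    have hmem : ∀ U : Finset V, ((B \ A) ∩ U).Nonempty →
        (∀ a b, G.Adj a b → a ∈ B → a ∉ A → a ∈ U → b ∈ B → b ∉ A → b ∈ U) →
        (B \ ((B \ A) ∩ U), A ∪ ((B \ A) ∩ U)) ∈ τ := by
      rintro U ⟨x, hx⟩ hU
      have hcap : B \ ((B \ A) ∩ U) ∩ (A ∪ ((B \ A) ∩ U)) = A ∩ B := by
        ext v
        simp only [mem_inter, mem_sdiff, mem_union]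
        tauto
      refine (hτ.2.1 _ _ ⟨?_, ?_⟩ (by rwa [hcap])).2 fun hmem => ?_
      · ext v
        have := hAB' v
        simp only [mem_inter, mem_sdiff, mem_union, mem_univ, iff_true]
        tauto
      · intro a ha b hb hab
        simp only [mem_inter, mem_sdiff, mem_union] at ha hb
        have h1 := hU b a hab.symm
        rcases hAB.adj_cases hab with h2 | h2 <;> tauto
      · have := hp.2 _ hmem subset_union_left sdiff_subset
        have h1 := congrArg Prod.fst this
        simp only at h1
        have h2 : x ∈ A := h1 ▸ mem_union_right _ hx
        simp only [mem_inter, mem_sdiff] at hx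
        tauto
    have m1 := hmem T hT1 hT'
    have m2 := hmem (univ \ T) (by
      obtain ⟨x, hx⟩ := hT2
      exact ⟨x, by simpa using hx⟩) (by
      intro a b hab h1 h2 h3 h4 h5
      have := hT' b a hab.symm h4 h5
      simp only [mem_sdiff, mem_univ, true_and] at h3 ⊢
      tauto)
    refine hτ.2.2 _ hp.1 _ m1 _ m2 ⟨fun v => ?_, fun u v huv => ?_⟩
    · have := hAB' v
      simp only [mem_inter, mem_sdiff, mem_univ]
      tauto
    · rcases hAB.adj_cases huv with h1 | h1
      · exact .inl h1
      by_cases huA : u ∈ A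
      · by_cases hvT : v ∈ T
        · refine .inr (.inr ?_)
          simp [h1, huA, hvT]
        · refine .inr (.inl ?_)
          simp [h1, huA, hvT]
      by_cases hvA : v ∈ A
      · by_cases huT : u ∈ T
        · refine .inr (.inr ?_)
          simp [h1, hvA, huT]
        · refine .inr (.inl ?_)
          simp [h1, hvA, huT]
      have h3 : u ∈ T ↔ v ∈ T :=
        ⟨fun h => hT' u v huv h1.1 huA h h1.2 hvA, fun h => hT' v u huv.symm h1.2 hvA h h1.1 huA⟩
      by_cases huT : u ∈ T
      · refine .inr (.inr ?_)
        simp [h1, huT, h3.1 huT]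
      · refine .inr (.inl ?_)
        simp [h1, huT, mt h3.2 huT]
  · intro a ha b hab
    simp only [mem_inter, mem_sdiff] at ha ⊢
    rcases hAB.adj_cases hab with h1 | h1 <;> tauto

end IsTangle

theorem abs_sideSign_le_one {α : Type*} [DecidableEq α] (p : Finset α × Finset α) (v : α) :
    |sideSign p v| ≤ 1 := by
  unfold sideSign
  split_ifs <;> simp

theorem IsTangle.exists_le_sum_mul_sideSign {G : SimpleGraph V} {k : ℕ}
    {τ : Set (Finset V × Finset V)} (hτ : IsTangle G k τ) {J : Type*} [Fintype J]
    {s : J → Finset V × Finset V} (hs : Function.Injective s) (hmax : ∀ j, IsMaxSep τ (s j))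
    {y : J → ℝ} (hy : y ∈ stdSimplex ℝ J) :
    ∃ v, 1 / (4 * (k : ℝ)) ≤ ∑ j, y j * sideSign (s j) v := by
  classical
  obtain ⟨hy0, hy1⟩ := hy
  have : Nonempty J := by
    by_contra h
    rw [not_nonempty_iff] at h
    simp at hy1
  have hk : 1 ≤ k := (Nat.zero_le _).trans_lt (hτ.1 _ (hmax (Classical.arbitrary J)).1).2
  have hk' : (1 : ℝ) ≤ k := by exact_mod_cast hk
  have hδ : 1 / (4 * (k : ℝ)) ≤ 1 / 4 := by
    apply one_div_le_one_div_of_le <;> linarith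
  by_cases hbig : ∃ j, 3 / 4 ≤ y j
  · obtain ⟨j, hj⟩ := hbig
    obtain ⟨v, hv⟩ := hτ.sdiff_nonempty (hmax j).1
    refine ⟨v, ?_⟩
    have hjv : sideSign (s j) v = 1 := by
      rw [mem_sdiff] at hv
      simp [sideSign, hv]
    have h := single_le_sum (f := fun i => y i * (sideSign (s i) v + 1))
      (fun i _ => mul_nonneg (hy0 i) (by linarith [(abs_le.1 (abs_sideSign_le_one (s i) v)).1]))
      (mem_univ j)
    simp only [mul_add, mul_one, sum_add_distrib, hy1, hjv] at h
    linarith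
  · push Not at hbig
    by_contra! hlt
    set f : J → J → ℝ := fun i j => ∑ v ∈ (s i).1 ∩ (s i).2, sideSign (s j) v with hf
    have hswap : ∑ i, y i * ∑ v ∈ (s i).1 ∩ (s i).2, ∑ j, y j * sideSign (s j) v
        = ∑ i, ∑ j, y i * y j * f i j := by
      refine sum_congr rfl fun i _ => ?_
      rw [sum_comm, mul_sum]
      refine sum_congr rfl fun j _ => ?_
      rw [hf, ← mul_sum, mul_assoc]
    have hup : ∑ i, y i * ∑ v ∈ (s i).1 ∩ (s i).2, ∑ j, y j * sideSign (s j) v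
        ≤ ∑ i, y i * (((k : ℝ) - 1) * (1 / (4 * k))) := by
      refine sum_le_sum fun i _ => mul_le_mul_of_nonneg_left ?_ (hy0 i)
      refine (sum_le_sum fun v _ => (hlt v).le).trans ?_
      rw [sum_const, nsmul_eq_mul]
      refine mul_le_mul_of_nonneg_right ?_ (by positivity)
      have : #((s i).1 ∩ (s i).2) + 1 ≤ k := (hτ.1 _ (hmax i).1).2
      rw [le_sub_iff_add_le]
      exact_mod_cast this
    rw [← sum_mul, hy1, one_mul] at hup
    have hcalc : ((k : ℝ) - 1) * (1 / (4 * k)) < 1 / 4 := by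
      field_simp
      linarith
    have hlow : ∀ i j, y i * y j * 2 - (if i = j then y i * y j * 2 else 0)
        ≤ y i * y j * f i j + y j * y i * f j i := by
      intro i j
      have hpos := mul_nonneg (hy0 i) (hy0 j)
      split_ifs with hij
      · subst hij
        have : f i i = 0 := by
          simp only [hf]
          rw [sum_sideSign, inter_assoc, inter_self, inter_right_comm, inter_self, sub_self]
        simp [this]
      · have h2 := hτ.two_le_sum_sideSign (hmax i) (hmax j) (hs.ne hij)
        have h3 : 2 ≤ f i j + f j i := h2
        nlinarith [mul_le_mul_of_nonneg_left h3 hpos]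
    have hsum := sum_le_sum fun i (_ : i ∈ univ) => sum_le_sum fun j (_ : j ∈ univ) => hlow i j
    have hcomm : ∑ i, ∑ j, y j * y i * f j i = ∑ i, ∑ j, y i * y j * f i j := sum_comm
    simp only [sum_add_distrib, sum_sub_distrib, hcomm] at hsum
    have h1 : ∑ i, ∑ j, y i * y j * 2 = 2 := by
      simp only [← sum_mul, ← mul_sum, hy1]
      norm_num
    have h2 : ∑ i, ∑ j, (if i = j then y i * y j * 2 else 0) ≤ 3 / 2 := by
      simp only [sum_ite_eq, mem_univ, if_true]
      calc ∑ i, y i * y i * 2 ≤ ∑ i, y i * (3 / 2) :=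
            sum_le_sum fun i _ => by nlinarith [hy0 i, hbig i]
        _ = 3 / 2 := by rw [← sum_mul, hy1, one_mul]
    rw [h1] at hsum
    rw [hswap] at hup
    linarith

/-- The minimax theorem for finite matrix games, with the value bounded below. -/
theorem exists_mem_stdSimplex_forall_le {I J : Type*} [Fintype I] [Fintype J] [Nonempty I]
    [Nonempty J] (M : J → I → ℝ) (δ : ℝ)
    (h : ∀ y ∈ stdSimplex ℝ J, ∃ i, δ ≤ ∑ j, y j * M j i) :
    ∃ w ∈ stdSimplex ℝ I, ∀ j, δ ≤ ∑ i, w i * M j i := by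
  classical
  set f : (J → ℝ) → (I → ℝ) → ℝ := fun y w => ∑ j, ∑ i, y j * w i * M j i with hf
  have lin₁ : ∀ w, ∃ l : (J → ℝ) →ₗ[ℝ] ℝ, ∀ y, f y w = l y := fun w =>
    ⟨∑ j, (∑ i, w i * M j i) • LinearMap.proj j, fun y => by
      simp only [hf, LinearMap.sum_apply, LinearMap.smul_apply, LinearMap.proj_apply, smul_eq_mul,
        sum_mul]
      exact sum_congr rfl fun j _ => sum_congr rfl fun i _ => by ring⟩
  have lin₂ : ∀ y, ∃ l : (I → ℝ) →ₗ[ℝ] ℝ, ∀ w, f y w = l w := fun y =>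
    ⟨∑ j, ∑ i, (y j * M j i) • LinearMap.proj i, fun w => by
      simp only [hf, LinearMap.sum_apply, LinearMap.smul_apply, LinearMap.proj_apply, smul_eq_mul]
      exact sum_congr rfl fun j _ => sum_congr rfl fun i _ => by ring⟩
  obtain ⟨a, ha, b, hb, hab⟩ := Sion.exists_isSaddlePointOn (f := f)
    (X := stdSimplex ℝ J) (Y := stdSimplex ℝ I)
    ⟨_, single_mem_stdSimplex ℝ (Classical.arbitrary J)⟩ (convex_stdSimplex ℝ J)
    (isCompact_stdSimplex ℝ J)
    (fun w _ => Continuous.continuousOn (by fun_prop) |>.lowerSemicontinuousOn)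
    (fun w _ => by
      obtain ⟨l, hl⟩ := lin₁ w
      simp only [hl]
      exact (l.convexOn (convex_stdSimplex ℝ J)).quasiconvexOn)
    (convex_stdSimplex ℝ I) ⟨_, single_mem_stdSimplex ℝ (Classical.arbitrary I)⟩
    (isCompact_stdSimplex ℝ I)
    (fun y _ => Continuous.continuousOn (by fun_prop) |>.upperSemicontinuousOn)
    (fun y _ => by
      obtain ⟨l, hl⟩ := lin₂ y
      simp only [hl]
      exact (l.concaveOn (convex_stdSimplex ℝ I)).quasiconcaveOn)
  refine ⟨b, hb, fun j => ?_⟩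
  obtain ⟨i, hi⟩ := h a ha
  have key := hab _ (single_mem_stdSimplex ℝ j) _ (single_mem_stdSimplex ℝ i)
  have e1 : f a (Pi.single i 1) = ∑ j, a j * M j i := by
    simp [hf, Pi.single_apply]
  have e2 : f (Pi.single j 1) b = ∑ i, b i * M j i := by
    simp [hf, Pi.single_apply]
  rw [e1, e2] at key
  exact hi.trans key

/-- Rounding a probability vector to a uniform distribution on a list of prescribed length. -/
theorem exists_sample_of_mem_stdSimplex {I : Type*} [Fintype I] {w : I → ℝ}
    (hw : w ∈ stdSimplex ℝ I) (L : ℕ) :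
    ∃ x : Fin L → I, ∀ m : I → ℝ, (∀ i, |m i| ≤ 1) →
      L * ∑ i, w i * m i - 2 * Fintype.card I ≤ ∑ a, m (x a) := by
  classical
  obtain ⟨hw0, hw1⟩ := hw
  have : Nonempty I := by
    by_contra h
    rw [not_nonempty_iff] at h
    simp at hw1
  have hLw : ∑ i, w i * L = L := by rw [← sum_mul, hw1, one_mul]
  set c : I → ℕ := fun i => ⌊w i * L⌋₊ with hc
  have hc₁ : ∀ i, (c i : ℝ) ≤ w i * L := fun i =>
    Nat.floor_le (mul_nonneg (hw0 i) (Nat.cast_nonneg L))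
  have hc₂ : ∀ i, w i * L ≤ c i + 1 := fun i => (Nat.lt_floor_add_one _).le
  have hcL : ∑ i, c i ≤ L := by
    have : ∑ i, (c i : ℝ) ≤ L := (sum_le_sum fun i _ => hc₁ i).trans_eq hLw
    exact_mod_cast this
  have hLc : (L : ℝ) ≤ ∑ i, (c i : ℝ) + Fintype.card I := by
    calc (L : ℝ) = ∑ i, w i * L := hLw.symm
      _ ≤ ∑ i, ((c i : ℝ) + 1) := sum_le_sum fun i _ => hc₂ i
      _ = _ := by simp [sum_add_distrib]
  have e : Fin L ≃ (Σ i, Fin (c i)) ⊕ Fin (L - ∑ i, c i) :=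
    Fintype.equivOfCardEq (by simp; omega)
  refine ⟨fun a => Sum.elim Sigma.fst (fun _ => Classical.arbitrary I) (e a), fun m hm => ?_⟩
  rw [e.sum_comp fun b => m (Sum.elim Sigma.fst (fun _ => Classical.arbitrary I) b)]
  simp only [Fintype.sum_sum_type, Sum.elim_inl, Sum.elim_inr, Fintype.sum_sigma, sum_const,
    card_univ, Fintype.card_fin, nsmul_eq_mul]
  rw [Nat.cast_sub hcL, Nat.cast_sum]
  have h1 : ∑ i, (L * (w i * m i) - 1) ≤ ∑ i, c i * m i := by
    refine sum_le_sum fun i _ => ?_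
    have := abs_le.1 (hm i)
    nlinarith [hc₁ i, hc₂ i]
  simp only [sum_sub_distrib, ← mul_sum, sum_const, card_univ, nsmul_eq_mul, mul_one] at h1
  have h2 : (∑ i, (c i : ℝ)) ≤ L := by exact_mod_cast hcL
  have := abs_le.1 (hm (Classical.arbitrary I))
  nlinarith

/-- A choice of signs for which no member of a small family of vectors has a very negative
signed sum. -/
theorem exists_forall_le_sum_sign {ι : Type*} [Fintype ι] (A : Finset (ι → ℝ))
    (hA : ∀ a ∈ A, ∀ i, |a i| ≤ 1) (l r : ℝ) (hl : 0 ≤ l)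
    (h : #A * Real.exp (l ^ 2 * Fintype.card ι / 2) < Real.exp (l * r)) :
    ∃ ε : ι → Bool, ∀ a ∈ A, -r ≤ ∑ i, (if ε i then a i else -a i) := by
  classical
  by_contra! hcon
  have hlow : ∀ ε : ι → Bool,
      Real.exp (l * r) ≤ ∑ a ∈ A, ∏ i, Real.exp (-l * if ε i then a i else -a i) := by
    intro ε
    obtain ⟨a, ha, hlt⟩ := hcon ε
    refine le_trans ?_ (single_le_sum (f := fun a : ι → ℝ =>
      ∏ i, Real.exp (-l * if ε i then a i else -a i))
      (fun b _ => prod_nonneg fun i _ => (Real.exp_pos _).le) ha)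
    rw [← Real.exp_sum, ← mul_sum]
    exact Real.exp_le_exp.2 (by nlinarith)
  have hsum := sum_le_sum fun ε (_ : ε ∈ (univ : Finset (ι → Bool))) => hlow ε
  rw [sum_comm, sum_const, card_univ, Fintype.card_fun, Fintype.card_bool, nsmul_eq_mul] at hsum
  have hup : ∀ a ∈ A, ∑ ε : ι → Bool, ∏ i, Real.exp (-l * if ε i then a i else -a i)
      ≤ 2 ^ Fintype.card ι * Real.exp (l ^ 2 * Fintype.card ι / 2) := by
    intro a ha
    have hprod := (prod_univ_sum (fun _ : ι => (univ : Finset Bool))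
      fun i b => Real.exp (-l * if b then a i else -a i)).symm
    rw [Fintype.piFinset_univ] at hprod
    rw [hprod]
    calc ∏ i, ∑ b : Bool, Real.exp (-l * if b then a i else -a i)
        ≤ ∏ _i : ι, 2 * Real.exp (l ^ 2 / 2) := by
          refine prod_le_prod (fun i _ => sum_nonneg fun b _ => (Real.exp_pos _).le) fun i _ => ?_
          have hcosh := Real.cosh_le_exp_half_sq (l * a i)
          rw [Real.cosh_eq] at hcosh
          have hmono : Real.exp ((l * a i) ^ 2 / 2) ≤ Real.exp (l ^ 2 / 2) := by
            refine Real.exp_le_exp.2 ?_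
            have := (sq_le_one_iff_abs_le_one _).2 (hA a ha i)
            rw [mul_pow]
            nlinarith [sq_nonneg l]
          simp only [Fintype.sum_bool, if_true, Bool.false_eq_true, if_false, neg_mul, mul_neg,
            neg_neg]
          linarith
      _ = _ := by
          rw [prod_const, card_univ, mul_pow, ← Real.exp_nat_mul]
          ring_nf
  have hle := hsum.trans (sum_le_sum hup)
  rw [sum_const, nsmul_eq_mul] at hle
  push_cast at hle
  have h2 : (0 : ℝ) < 2 ^ Fintype.card ι := by positivity
  nlinarith

theorem exists_sample_half {I J : Type*} [Finite J] (m : J → I → ℝ)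
    (hm : ∀ j i, |m j i| ≤ 1) (D : ℕ)
    (hD : ∀ (n : ℕ) (x : Fin n → I), (Set.range fun j => m j ∘ x).ncard ≤ (n + 1) ^ D)
    {n : ℕ} (hn : 1 ≤ n) (x : Fin (2 * n) → I) :
    ∃ x' : Fin n → I, ∀ j, (∑ a, m j (x a)) / 2 - (4 * D + 1) * (1 / √√(n : ℝ)) * n
      ≤ ∑ a, m j (x' a) := by
  classical
  have e : Fin n × Bool ≃ Fin (2 * n) := Fintype.equivOfCardEq (by simp [mul_comm])
  set T : (Fin (2 * n) → ℝ) → Fin n → ℝ := fun f i => (f (e (i, true)) - f (e (i, false))) / 2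
    with hT
  have hfin : (Set.range fun j => m j ∘ x).Finite := Set.finite_range _
  set A : Finset (Fin n → ℝ) := hfin.toFinset.image T with hA
  have hAcard : (#A : ℝ) ≤ (2 * n + 1) ^ D := by
    have h1 : #A ≤ (2 * n + 1) ^ D := by
      refine card_image_le.trans ?_
      rw [← Set.ncard_eq_toFinset_card _ hfin]
      exact hD _ x
    exact_mod_cast h1
  have hn' : (1 : ℝ) ≤ n := by exact_mod_cast hn
  have hs : (1 : ℝ) ≤ √(n : ℝ) := Real.one_le_sqrt.2 hn'
  have hss : (1 : ℝ) ≤ √√(n : ℝ) := Real.one_le_sqrt.2 hs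
  have hsq : √(n : ℝ) ^ 2 = n := Real.sq_sqrt (by linarith)
  have hssq : √√(n : ℝ) ^ 2 = √(n : ℝ) := Real.sq_sqrt (by linarith)
  obtain ⟨ε, hε⟩ := exists_forall_le_sum_sign A (by
    intro a ha i
    simp only [hA, mem_image, Set.Finite.mem_toFinset, Set.mem_range] at ha
    obtain ⟨_, ⟨j, rfl⟩, rfl⟩ := ha
    have h1 := abs_le.1 (hm j (x (e (i, true))))
    have h2 := abs_le.1 (hm j (x (e (i, false))))
    simp only [hT, Function.comp_apply]
    rw [abs_le]
    constructor <;> linarith) (1 / √√(n : ℝ)) ((4 * D + 1) * (1 / √√(n : ℝ)) * n)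
    (by positivity) (by
      have e1 : (1 / √√(n : ℝ)) * ((4 * D + 1) * (1 / √√(n : ℝ)) * n) = (4 * D + 1) * √(n : ℝ) := by
        field_simp
        rw [hssq, ← pow_two, hsq]
      have e2 : (1 / √√(n : ℝ)) ^ 2 * Fintype.card (Fin n) / 2 = √(n : ℝ) / 2 := by
        rw [Fintype.card_fin, one_div, inv_pow, hssq]
        field_simp
        exact hsq.symm
      rw [e1, e2]
      have hlog : Real.log (2 * n + 1) ≤ 4 * √(n : ℝ) := by
        have h1 := Real.log_le_sub_one_of_pos (show 0 < √(2 * (n : ℝ) + 1) by positivity)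
        rw [Real.log_sqrt (by positivity)] at h1
        have h2 : √(2 * (n : ℝ) + 1) ≤ 2 * √(n : ℝ) := by
          rw [Real.sqrt_le_left (by positivity), mul_pow, hsq]
          linarith
        linarith
      have hpow : ((2 : ℝ) * n + 1) ^ D ≤ Real.exp (4 * D * √(n : ℝ)) := by
        rw [← Real.log_le_iff_le_exp (by positivity), Real.log_pow]
        nlinarith [(Nat.cast_nonneg D : (0 : ℝ) ≤ D)]
      calc #A * Real.exp (√(n : ℝ) / 2)
          ≤ Real.exp (4 * D * √(n : ℝ)) * Real.exp (√(n : ℝ) / 2) :=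
            mul_le_mul_of_nonneg_right (hAcard.trans hpow) (Real.exp_pos _).le
        _ < _ := by
            rw [← Real.exp_add]
            exact Real.exp_lt_exp.2 (by nlinarith))
  refine ⟨fun i => x (e (i, ε i)), fun j => ?_⟩
  have hj := hε (T (m j ∘ x)) (mem_image_of_mem _ (by simp))
  have hsplit : ∑ a, m j (x a) = ∑ i, (m j (x (e (i, true))) + m j (x (e (i, false)))) := by
    rw [← e.sum_comp fun a => m j (x a), Fintype.sum_prod_type]
    simp
  have hcomb : ∑ i, m j (x (e (i, ε i))) = (∑ a, m j (x a)) / 2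
      + ∑ i, (if ε i then T (m j ∘ x) i else -T (m j ∘ x) i) := by
    rw [hsplit, sum_div, ← sum_add_distrib]
    refine sum_congr rfl fun i _ => ?_
    cases ε i <;> simp [hT] <;> ring
  linarith

theorem exists_sample_descend {I J : Type*} [Finite J] (m : J → I → ℝ)
    (hm : ∀ j i, |m j i| ≤ 1) (D : ℕ)
    (hD : ∀ (n : ℕ) (x : Fin n → I), (Set.range fun j => m j ∘ x).ncard ≤ (n + 1) ^ D)
    {N : ℕ} (hN : 1 ≤ N) (β : ℝ) (t : ℕ) {L : ℕ} (hL : L = 2 ^ t * N) (x : Fin L → I)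
    (hx : ∀ j, (β - 8 * (4 * D + 1) * (1 / √√(L : ℝ))) * L ≤ ∑ a, m j (x a)) :
    ∃ x' : Fin N → I, ∀ j, (β - 8 * (4 * D + 1) * (1 / √√(N : ℝ))) * N ≤ ∑ a, m j (x' a) := by
  induction t generalizing L with
  | zero =>
    obtain rfl : L = N := by simpa using hL
    exact ⟨x, hx⟩
  | succ t ih =>
    obtain ⟨n, rfl⟩ : ∃ n, L = 2 * n := ⟨2 ^ t * N, by rw [hL]; ring⟩
    have hn : n = 2 ^ t * N := by
      rw [pow_succ] at hL
      linarith
    have hn1 : 1 ≤ n := by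
      rw [hn]
      exact Nat.mul_pos (by positivity) hN
    obtain ⟨x', hx'⟩ := exists_sample_half m hm D hD hn1 x
    refine ih hn x' fun j => le_trans ?_ (hx' j)
    have hn' : (1 : ℝ) ≤ n := by exact_mod_cast hn1
    have hφ : 1 / √√((2 * n : ℕ) : ℝ) ≤ 7 / 8 * (1 / √√(n : ℝ)) := by
      have h8 : (8 / 7 : ℝ) ≤ √√2 :=
        Real.le_sqrt_of_sq_le (Real.le_sqrt_of_sq_le (by norm_num))
      have hpos : 0 < √√(n : ℝ) := Real.sqrt_pos.2 (Real.sqrt_pos.2 (by linarith))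
      rw [Nat.cast_mul, Nat.cast_ofNat, Real.sqrt_mul zero_le_two, Real.sqrt_mul (Real.sqrt_nonneg _),
        ← one_div_mul_one_div]
      refine mul_le_mul_of_nonneg_right ?_ (by positivity)
      rw [div_le_iff₀ (by linarith)]
      linarith
    have hj := hx j
    have hφ' := mul_le_mul_of_nonneg_left hφ (show (0 : ℝ) ≤ 8 * (4 * D + 1) * n by positivity)
    push_cast at hj hφ' ⊢
    linarith

/-- A finite matrix game whose rows have polynomially growing traces on samples of columns has a
good strategy that is uniform on a list of columns of bounded length. -/
theorem exists_sample_forall_pos {I J : Type*} [Fintype I] [Fintype J] [Nonempty J]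
    (m : J → I → ℝ) (hm : ∀ j i, |m j i| ≤ 1) (D : ℕ)
    (hD : ∀ (n : ℕ) (x : Fin n → I), (Set.range fun j => m j ∘ x).ncard ≤ (n + 1) ^ D)
    {δ : ℝ} (hδ : 0 < δ) {N : ℕ} (hN : 1 ≤ N) (hδN : 16 * (4 * D + 1) * (1 / √√(N : ℝ)) < δ)
    (h : ∀ y ∈ stdSimplex ℝ J, ∃ i, δ ≤ ∑ j, y j * m j i) :
    ∃ x : Fin N → I, ∀ j, 0 < ∑ a, m j (x a) := by
  classical
  have hI : Nonempty I :=
    ⟨(h _ (single_mem_stdSimplex ℝ (Classical.arbitrary J))).choose⟩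
  obtain ⟨w, hw, hwδ⟩ := exists_mem_stdSimplex_forall_le m δ h
  have hN' : (1 : ℝ) ≤ N := by exact_mod_cast hN
  obtain ⟨t, ht⟩ := pow_unbounded_of_one_lt (4 * Fintype.card I / δ) (one_lt_two (α := ℝ))
  obtain ⟨x, hx⟩ := exists_sample_of_mem_stdSimplex hw (2 ^ t * N)
  obtain ⟨x', hx'⟩ := exists_sample_descend m hm D hD hN (δ / 2) t rfl x fun j => by
    have h1 := hx (m j) (hm j)
    have h2 : 4 * (Fintype.card I : ℝ) ≤ δ * (2 ^ t * N : ℕ) := by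
      rw [div_lt_iff₀ hδ] at ht
      push_cast
      nlinarith [show (0 : ℝ) < δ * 2 ^ t by positivity]
    have h3 := mul_le_mul_of_nonneg_left (hwδ j) (Nat.cast_nonneg (α := ℝ) (2 ^ t * N))
    have h4 : (0 : ℝ) ≤ 8 * (4 * D + 1) * (1 / √√((2 ^ t * N : ℕ) : ℝ)) * (2 ^ t * N : ℕ) := by
      positivity
    linarith
  refine ⟨x', fun j => lt_of_lt_of_le ?_ (hx' j)⟩
  exact mul_pos (by linarith) (by linarith)

theorem sum_Iic_choose_le (n d : ℕ) : ∑ i ∈ Iic d, n.choose i ≤ (n + 1) ^ d := by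
  induction d with
  | zero => simp [show (Iic 0 : Finset ℕ) = {0} from rfl]
  | succ d ih =>
    rw [← Nat.range_succ_eq_Iic, sum_range_succ, Nat.range_succ_eq_Iic, pow_succ]
    have h1 : n.choose (d + 1) ≤ n * (n + 1) ^ d :=
      (Nat.choose_le_pow n (d + 1)).trans (by
        rw [pow_succ, mul_comm]
        gcongr
        omega)
    nlinarith

/-- The Sauer–Shelah bound for the traces of a family of sets on a finite sequence. -/
theorem card_image_preimage_le {I J : Type*} [Fintype J] [DecidableEq I] (C : J → Finset I)
    {d n : ℕ} (hC : ∀ X : Finset I, (∀ Y ⊆ X, ∃ j, X ∩ C j = Y) → #X ≤ d) (x : Fin n → I) :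
    #(univ.image fun j => univ.filter fun a => x a ∈ C j) ≤ (n + 1) ^ d := by
  set A := univ.image fun j => univ.filter fun a => x a ∈ C j with hA
  have hvc : A.vcDim ≤ d := by
    refine Finset.sup_le fun s hs => ?_
    rw [mem_shatterer] at hs
    have hinj : Set.InjOn x s := by
      intro a ha b hb hab
      by_contra hne
      obtain ⟨u, hu, hsu⟩ := hs.exists_inter_eq_singleton ha
      obtain ⟨j, -, rfl⟩ := mem_image.1 hu
      have ha' : a ∈ s ∩ univ.filter fun c => x c ∈ C j := by simp [hsu]
      have hb' : b ∈ s ∩ univ.filter fun c => x c ∈ C j := by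
        simp only [mem_inter, mem_filter, mem_univ, true_and] at ha' ⊢
        exact ⟨hb, hab ▸ ha'.2⟩
      rw [hsu, mem_singleton] at hb'
      exact hne hb'.symm
    rw [← card_image_of_injOn hinj]
    refine hC _ fun Y hY => ?_
    obtain ⟨u, hu, hsu⟩ := hs (filter_subset (fun a => x a ∈ Y) s)
    obtain ⟨j, -, rfl⟩ := mem_image.1 hu
    refine ⟨j, ?_⟩
    ext v
    simp only [mem_inter, mem_image]
    constructor
    · rintro ⟨⟨a, ha, rfl⟩, hj⟩
      have : a ∈ s ∩ univ.filter fun c => x c ∈ C j := by simp [ha, hj]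
      rw [hsu] at this
      exact (mem_filter.1 this).2
    · intro hv
      obtain ⟨a, ha, rfl⟩ := mem_image.1 (hY hv)
      have : a ∈ s.filter fun a => x a ∈ Y := mem_filter.2 ⟨ha, hv⟩
      rw [← hsu] at this
      exact ⟨⟨a, ha, rfl⟩, (mem_filter.1 (mem_inter.1 this).2).2⟩
  calc #A ≤ #A.shatterer := card_le_card_shatterer A
    _ ≤ ∑ i ∈ Iic A.vcDim, (Fintype.card (Fin n)).choose i := card_shatterer_le_sum_vcDim
    _ ≤ ∑ i ∈ Iic d, n.choose i := by
      rw [Fintype.card_fin]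
      exact sum_le_sum_of_subset (Iic_subset_Iic.2 hvc)
    _ ≤ (n + 1) ^ d := sum_Iic_choose_le n d

theorem IsTangle.ncard_range_sideSign_le {G : SimpleGraph V} {k : ℕ}
    {τ : Set (Finset V × Finset V)} (hτ : IsTangle G k τ) {J : Type*} [Finite J]
    {s : J → Finset V × Finset V} (hmax : ∀ j, IsMaxSep τ (s j)) {n : ℕ} (x : Fin n → V) :
    (Set.range fun j => sideSign (s j) ∘ x).ncard ≤ (n + 1) ^ (shatterBound k + k) := by
  classical
  have := Fintype.ofFinite J
  have hbig : #(univ.image fun j => univ.filter fun a => x a ∈ (s j).2 \ (s j).1)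
      ≤ (n + 1) ^ shatterBound k := by
    refine card_image_preimage_le _ (fun X hX => ?_) x
    refine (card_lt_shatterBound (G := G) k ∅
      (Set.range fun j => ((s j).1 ∩ (s j).2, (s j).2 \ (s j).1)) ?_ X ?_).le
    · rintro _ ⟨j, rfl⟩
      refine ⟨hτ.isComponentOff (hmax j), empty_subset _, ?_⟩
      rw [sdiff_empty]
      exact (hτ.1 _ (hmax j).1).2
    · intro Y hY
      obtain ⟨j, hj⟩ := hX Y hY
      exact ⟨_, ⟨j, rfl⟩, hj⟩
  have hsep : #(univ.image fun j => univ.filter fun a => x a ∈ (s j).1 ∩ (s j).2)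
      ≤ (n + 1) ^ k := by
    refine card_image_preimage_le _ (fun X hX => ?_) x
    obtain ⟨j, hj⟩ := hX X Subset.rfl
    exact (card_le_card (inter_eq_left.1 hj)).trans (hτ.1 _ (hmax j).1).2.le
  set P := univ.image fun j => univ.filter fun a => x a ∈ (s j).2 \ (s j).1 with hP
  set Q := univ.image fun j => univ.filter fun a => x a ∈ (s j).1 ∩ (s j).2 with hQ
  have hsub : (Set.range fun j => sideSign (s j) ∘ x) ⊆
      ((P ×ˢ Q).image fun q a => (if a ∈ q.1 then (1 : ℝ) else if a ∈ q.2 then 0 else -1) :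
        Finset (Fin n → ℝ)) := by
    rintro _ ⟨j, rfl⟩
    rw [mem_coe, mem_image]
    refine ⟨(_, _), mem_product.2 ⟨mem_image_of_mem _ (mem_univ j),
      mem_image_of_mem _ (mem_univ j)⟩, ?_⟩
    ext a
    have := (hτ.1 _ (hmax j).1).1.mem_or_mem (x a)
    simp only [mem_sdiff, mem_inter, Function.comp_apply, sideSign]
    by_cases h1 : x a ∈ (s j).1 <;> by_cases h2 : x a ∈ (s j).2 <;> simp_all
  calc _ ≤ #((P ×ˢ Q).image fun q a =>
        (if a ∈ q.1 then (1 : ℝ) else if a ∈ q.2 then 0 else -1)) := by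
        rw [← Set.ncard_coe_finset]
        exact Set.ncard_le_ncard hsub (finite_toSet _)
    _ ≤ #P * #Q := card_image_le.trans_eq (card_product _ _)
    _ ≤ _ := by
      rw [pow_add]
      exact Nat.mul_le_mul hbig hsep

/-- For every `k ≥ 1` there is a `K` such that every `k`-tangle in any graph `G` is induced by
a weight function on `V(G)` of total weight at most `K`; in particular the support of this
weight function has size at most `K`. -/
theorem stmt2 (k : ℕ) (hk : 1 ≤ k) :
    ∃ K : ℕ, ∀ (V : Type) [Fintype V] [DecidableEq V] (G : SimpleGraph V)
      (τ : Set (Finset V × Finset V)), IsTangle G k τ →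
      ∃ w : V → ℕ, InducesW τ w ∧ (∑ v : V, w v) ≤ K ∧
        (Finset.univ.filter fun v : V => w v ≠ 0).card ≤ K := by
  set D := shatterBound k + k with hD
  set c := 64 * k * (4 * D + 1) + 1 with hc
  refine ⟨c ^ 4, fun V _ _ G τ hτ => ?_⟩
  classical
  rcases isEmpty_or_nonempty {q // IsMaxSep τ q} with hJ | hJ
  · refine ⟨0, fun p hp => ?_, by simp, by simp⟩
    obtain ⟨q, hq, -⟩ := exists_isMaxSep hp
    exact (hJ.false ⟨q, hq⟩).elim
  have hk' : (1 : ℝ) ≤ k := by exact_mod_cast hk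
  have hroot : √√((c ^ 4 : ℕ) : ℝ) = c := by
    rw [show ((c ^ 4 : ℕ) : ℝ) = ((c : ℝ) ^ 2) ^ 2 by push_cast; ring,
      Real.sqrt_sq (by positivity), Real.sqrt_sq (by positivity)]
  obtain ⟨x, hx⟩ := exists_sample_forall_pos (N := c ^ 4) (δ := 1 / (4 * (k : ℝ)))
    (fun q : {q // IsMaxSep τ q} => sideSign q.1) (fun q => abs_sideSign_le_one q.1) D
    (fun n x => hτ.ncard_range_sideSign_le (fun q => q.2) x) (by positivity)
    (Nat.one_le_pow _ _ (by omega))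
    (by
      have hc' : (c : ℝ) = 64 * k * (4 * D + 1) + 1 := by
        rw [hc]
        push_cast
        ring
      rw [hroot, mul_one_div, div_lt_div_iff₀ (by rw [hc']; positivity) (by positivity), hc']
      linarith)
    (fun y hy => hτ.exists_le_sum_mul_sideSign Subtype.val_injective (fun q => q.2) hy)
  set w : V → ℕ := fun v => #{a | x a = v} with hw
  have hsum : ∀ S : Finset V, ∑ v ∈ S, w v = #{a | x a ∈ S} := fun S => by
    rw [card_eq_sum_card_fiberwise (s := {a | x a ∈ S}) (f := x) (t := S)
      (fun a ha => by simpa using ha)]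
    refine sum_congr rfl fun v hv => congrArg card ?_
    ext a
    simp only [mem_filter, mem_univ, true_and]
    exact ⟨fun h => ⟨h ▸ hv, h⟩, fun h => h.2⟩
  have htotal : ∑ v, w v = c ^ 4 := by simp [hsum]
  refine ⟨w, fun p hp => ?_, htotal.le, ?_⟩
  · obtain ⟨q, hq, h1, h2⟩ := exists_isMaxSep hp
    have hpos := hx ⟨q, hq⟩
    simp only [sideSign, sum_sub_distrib, sum_boole, sub_pos, Nat.cast_lt] at hpos
    rw [← hsum, ← hsum] at hpos
    exact (sum_le_sum_of_subset h1).trans_lt (hpos.trans_le (sum_le_sum_of_subset h2))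
  · rw [← htotal, card_eq_sum_ones, ← sum_filter_ne_zero (f := w)]
    exact sum_le_sum fun v hv => Nat.one_le_iff_ne_zero.2 (mem_filter.1 hv).2
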